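/- arXiv:2102.04858 — 3 statements merged into one kernel-verified Lean document; each statement's English description precedes it below -/
import Mathlib

section
/- At every point p ∈ ℝ^{2n} with N(p) ≠ 0 and for every vector v, ω(R_k(p), v) = −(1/N(p)) · D H_k(p)(v). In particular ω(R_k(p), v) = 0 for all v in the kernel of D H_k(p), i.e. for all v tangent to the level hypersurface of H_k through p; together with α_k(R_k) = 1 this identifies R_k as the Reeb vector field of the contact form α_k on the hypersurfaces {H_k = ±δ}. -/
open scoped BigOperators

noncomputable section

/-- ℝ^{2n}, identified with n copies of ℝ²: a point `p` has coordinates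
`x_j = p.1 j` and `y_j = p.2 j`. -/
abbrev Vn (n : ℕ) : Type := (Fin n → ℝ) × (Fin n → ℝ)

/-- The standard symplectic form ω(u,v) = Σ_j (u_{x_j} v_{y_j} − u_{y_j} v_{x_j}). -/
def omegaForm (n : ℕ) (u v : Vn n) : ℝ :=
  ∑ j : Fin n, (u.1 j * v.2 j - u.2 j * v.1 j)

/-- The Liouville vector field Z_k, with components (2x_j, −y_j) for j ≤ k
and (½x_j, ½y_j) for j > k. -/
def Zfield (n k : ℕ) (p : Vn n) : Vn n :=
  (fun j => if (j : ℕ) < k then 2 * p.1 j else (1 / 2) * p.1 j,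
   fun j => if (j : ℕ) < k then -p.2 j else (1 / 2) * p.2 j)

/-- The 1-form α_k(p)(v) = Σ_{j≤k}(2x_j v_{y_j} + y_j v_{x_j}) + Σ_{j>k} ½(x_j v_{y_j} − y_j v_{x_j}). -/
def alphaForm (n k : ℕ) (p v : Vn n) : ℝ :=
  ∑ j : Fin n,
    if (j : ℕ) < k then 2 * p.1 j * v.2 j + p.2 j * v.1 j
    else (1 / 2) * (p.1 j * v.2 j - p.2 j * v.1 j)

/-- H_k(p) = Σ_{j≤k}(x_j² − ½y_j²) + Σ_{j>k} ¼(x_j² + y_j²). -/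
def Hfun (n k : ℕ) (p : Vn n) : ℝ :=
  ∑ j : Fin n,
    if (j : ℕ) < k then (p.1 j) ^ 2 - (1 / 2) * (p.2 j) ^ 2
    else (1 / 4) * ((p.1 j) ^ 2 + (p.2 j) ^ 2)

/-- N(p) = Σ_{j≤k}(4x_j² + y_j²) + Σ_{j>k} ¼(x_j² + y_j²). -/
def Nfun (n k : ℕ) (p : Vn n) : ℝ :=
  ∑ j : Fin n,
    if (j : ℕ) < k then 4 * (p.1 j) ^ 2 + (p.2 j) ^ 2
    else (1 / 4) * ((p.1 j) ^ 2 + (p.2 j) ^ 2)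

/-- The unnormalized Reeb vector field w, with components (y_j, 2x_j) for j ≤ k
and (−½y_j, ½x_j) for j > k. -/
def wField (n k : ℕ) (p : Vn n) : Vn n :=
  (fun j => if (j : ℕ) < k then p.2 j else -(1 / 2) * p.2 j,
   fun j => if (j : ℕ) < k then 2 * p.1 j else (1 / 2) * p.1 j)

/-- The normalized Reeb vector field R_k(p) = (1/N(p)) · w(p). -/
noncomputable def Rfield (n k : ℕ) (p : Vn n) : Vn n :=
  (Nfun n k p)⁻¹ • wField n k p

theorem hasFDerivAt_coord_fst {n : ℕ} (p : Vn n) (j : Fin n) :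
    HasFDerivAt (fun q : Vn n => q.1 j)
      ((ContinuousLinearMap.proj (R := ℝ) (φ := fun _ : Fin n => ℝ) j).comp
        (ContinuousLinearMap.fst ℝ (Fin n → ℝ) (Fin n → ℝ))) p :=
  ((ContinuousLinearMap.proj (R := ℝ) (φ := fun _ : Fin n => ℝ) j).comp
    (ContinuousLinearMap.fst ℝ (Fin n → ℝ) (Fin n → ℝ))).hasFDerivAt

theorem hasFDerivAt_coord_snd {n : ℕ} (p : Vn n) (j : Fin n) :
    HasFDerivAt (fun q : Vn n => q.2 j)
      ((ContinuousLinearMap.proj (R := ℝ) (φ := fun _ : Fin n => ℝ) j).comp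
        (ContinuousLinearMap.snd ℝ (Fin n → ℝ) (Fin n → ℝ))) p :=
  ((ContinuousLinearMap.proj (R := ℝ) (φ := fun _ : Fin n => ℝ) j).comp
    (ContinuousLinearMap.snd ℝ (Fin n → ℝ) (Fin n → ℝ))).hasFDerivAt

/-- `H_k` is differentiable, with differential `v ↦ -ω(w(p), v)`. -/
theorem hasFDerivAt_Hfun (n k : ℕ) (p : Vn n) :
    ∃ L : Vn n →L[ℝ] ℝ, HasFDerivAt (Hfun n k) L p ∧
      ∀ v, L v = -omegaForm n (wField n k p) v := by
  have summand : ∀ j : Fin n, ∃ L : Vn n →L[ℝ] ℝ,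
      HasFDerivAt (fun q : Vn n => if (j : ℕ) < k then (q.1 j) ^ 2 - (1 / 2) * (q.2 j) ^ 2
        else (1 / 4) * ((q.1 j) ^ 2 + (q.2 j) ^ 2)) L p ∧
      ∀ v, L v = -((wField n k p).1 j * v.2 j - (wField n k p).2 j * v.1 j) := by
    intro j
    have hx := (hasFDerivAt_coord_fst p j).pow 2
    have hy := (hasFDerivAt_coord_snd p j).pow 2
    by_cases hj : (j : ℕ) < k
    · simp only [hj, if_true]
      refine ⟨_, hx.sub (hy.const_mul (1 / 2)), fun v => ?_⟩
      simp [wField, hj]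
      ring
    · simp only [hj, if_false]
      refine ⟨_, (hx.add hy).const_mul (1 / 4), fun v => ?_⟩
      simp [wField, hj]
      ring
  choose L hL hLv using summand
  refine ⟨∑ j, L j, HasFDerivAt.fun_sum fun j _ => hL j, fun v => ?_⟩
  simp [omegaForm, hLv]

theorem fderiv_Hfun_apply (n k : ℕ) (p v : Vn n) :
    fderiv ℝ (Hfun n k) p v = -omegaForm n (wField n k p) v := by
  obtain ⟨L, hL, hLv⟩ := hasFDerivAt_Hfun n k p
  rw [hL.fderiv, hLv]

theorem omegaForm_smul_left (n : ℕ) (c : ℝ) (u v : Vn n) :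
    omegaForm n (c • u) v = c * omegaForm n u v := by
  simp only [omegaForm, Finset.mul_sum, Prod.smul_fst, Prod.smul_snd, Pi.smul_apply, smul_eq_mul]
  exact Finset.sum_congr rfl fun j _ => by ring

/-- at every point with N(p) ≠ 0 and every vector v,
ω(R_k(p), v) = −(1/N(p)) · D H_k(p)(v); in particular ω(R_k(p), v) = 0 for all v
in the kernel of D H_k(p), i.e. for vectors tangent to the level hypersurface of
H_k through p. -/
theorem reeb_contracts_omega (n k : ℕ) (hn : 1 ≤ n) (hk : k ≤ n) :
    (∀ p : Vn n, Nfun n k p ≠ 0 → ∀ v : Vn n,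
      omegaForm n (Rfield n k p) v = -(Nfun n k p)⁻¹ * fderiv ℝ (Hfun n k) p v) ∧
    (∀ p : Vn n, Nfun n k p ≠ 0 → ∀ v : Vn n,
      fderiv ℝ (Hfun n k) p v = 0 → omegaForm n (Rfield n k p) v = 0) := by
  have contraction : ∀ p v : Vn n,
      omegaForm n (Rfield n k p) v = -(Nfun n k p)⁻¹ * fderiv ℝ (Hfun n k) p v := by
    intro p v
    rw [Rfield, omegaForm_smul_left, fderiv_Hfun_apply]
    ring
  refine ⟨fun p _ v => contraction p v, fun p _ v hv => ?_⟩
  rw [contraction, hv, mul_zero]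
end
end

section
/- Let β : ℝ → ℝ be continuous with β(t) > 0 for all t, and let γ = (γ₁, γ₂) : ℝ → ℝ² be a differentiable curve satisfying γ₁'(t) = β(t)·γ₂(t) and γ₂'(t) = 2β(t)·γ₁(t) for all t. If γ is periodic, i.e. there exists T > 0 with γ(t + T) = γ(t) for all t, then γ is identically (0,0). (Thus every Reeb orbit in the handle model lies in the middle of the handle, over (x,y) = (0,0).) -/
/-- A monotone periodic function on the reals is constant. -/
theorem Monotone.eq_of_periodic {α : Type*} [PartialOrder α] {f : ℝ → α} {T : ℝ}
    (hf : Monotone f) (hper : Function.Periodic f T) (hT : 0 < T) (x y : ℝ) : f x = f y := by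
  have key : ∀ a b, f a ≤ f b := fun a b ↦ by
    obtain ⟨n, hn⟩ := Archimedean.arch (a - b) hT
    rw [nsmul_eq_mul] at hn
    calc f a ≤ f (b + n * T) := hf (by linarith)
      _ = f b := hper.nat_mul n b
  exact le_antisymm (key x y) (key y x)

/-- if β : ℝ → ℝ is continuous and positive and γ = (γ₁,γ₂) : ℝ → ℝ²
is a differentiable curve satisfying γ₁' = β·γ₂ and γ₂' = 2β·γ₁ which is periodic
of some period T > 0, then γ ≡ (0,0). Thus every Reeb orbit in the handle model
lies in the middle of the handle, over (x,y) = (0,0). -/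
theorem handle_flow_periodic_orbit (β γ₁ γ₂ : ℝ → ℝ) (hβ : Continuous β)
    (hβpos : ∀ t, 0 < β t)
    (h₁ : ∀ t, HasDerivAt γ₁ (β t * γ₂ t) t)
    (h₂ : ∀ t, HasDerivAt γ₂ (2 * β t * γ₁ t) t)
    (hper : ∃ T : ℝ, 0 < T ∧ ∀ t, γ₁ (t + T) = γ₁ t ∧ γ₂ (t + T) = γ₂ t) :
    ∀ t : ℝ, γ₁ t = 0 ∧ γ₂ t = 0 := by
  obtain ⟨T, hT, hγ⟩ := hper
  have hderiv : ∀ t, HasDerivAt (fun s ↦ γ₁ s * γ₂ s) (β t * (γ₂ t ^ 2 + 2 * γ₁ t ^ 2)) t :=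
    fun t ↦ ((h₁ t).fun_mul (h₂ t)).congr_deriv (by ring)
  have hmono : Monotone fun s ↦ γ₁ s * γ₂ s :=
    monotone_of_hasDerivAt_nonneg hderiv fun t ↦
      mul_nonneg (hβpos t).le (by positivity)
  have hperiodic : Function.Periodic (fun s ↦ γ₁ s * γ₂ s) T := fun t ↦ by
    simp only [(hγ t).1, (hγ t).2]
  intro t
  have hconst : (fun s ↦ γ₁ s * γ₂ s) = fun _ ↦ γ₁ t * γ₂ t :=
    funext fun s ↦ hmono.eq_of_periodic hperiodic hT s t
  have hzero : β t * (γ₂ t ^ 2 + 2 * γ₁ t ^ 2) = 0 :=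
    (hderiv t).unique (hconst ▸ hasDerivAt_const t (γ₁ t * γ₂ t))
  have hsum := (mul_eq_zero.mp hzero).resolve_left (hβpos t).ne'
  constructor <;> refine sq_eq_zero_iff.mp ?_ <;>
    linarith [hsum, sq_nonneg (γ₁ t), sq_nonneg (γ₂ t)]
end

section
/- Let b > 0, let β : ℝ → ℝ be continuous with β(t) ≥ b for all t, and let γ = (γ₁, γ₂) : ℝ → ℝ² be a differentiable curve satisfying γ₁'(t) = β(t)·γ₂(t) and γ₂'(t) = 2β(t)·γ₁(t) for all t. If γ(0) ≠ (0,0), then the range of γ is unbounded in ℝ². (Thus a Reeb flow line of the handle model whose planar coordinate is not at the origin escapes the handle.) -/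
/-- A solution of the linear equation with rate `a ≥ c > 0` and `w 0 ≠ 0` is unbounded. -/
theorem exists_lt_abs_of_hasDerivAt_mul_self {c : ℝ} (hc : 0 < c) {a w : ℝ → ℝ}
    (ha : ∀ t, c ≤ a t) (hw : ∀ t, HasDerivAt w (a t * w t) t) (hw0 : w 0 ≠ 0) (M : ℝ) :
    ∃ t, M < |w t| := by
  have hsq : ∀ t, HasDerivAt (fun s => w s ^ 2) (2 * a t * w t ^ 2) t := fun t => by
    refine ((hw t).pow 2).congr_deriv ?_
    push_cast
    ring
  have hmono : Monotone fun s => w s ^ 2 :=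
    monotone_of_hasDerivAt_nonneg hsq fun t => by
      have := hc.trans_le (ha t)
      positivity
  have hpos : 0 < w 0 ^ 2 := by positivity
  have hk : 0 < 2 * c * w 0 ^ 2 := by positivity
  have hgrowth : ∀ t, 0 ≤ t → 2 * c * w 0 ^ 2 * t ≤ w t ^ 2 - w 0 ^ 2 := fun t ht => by
    have := (convex_Ici (0 : ℝ)).mul_sub_le_image_sub_of_le_deriv (f := fun s => w s ^ 2)
      (C := 2 * c * w 0 ^ 2) (fun x _ => (hsq x).continuousAt.continuousWithinAt)
      (fun x _ => (hsq x).differentiableAt.differentiableWithinAt)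
      (fun x hx => by
        rw [(hsq x).deriv]
        have hx0 : (0 : ℝ) ≤ x := interior_subset hx
        have hle : w 0 ^ 2 ≤ w x ^ 2 := hmono hx0
        have hax := ha x
        have := hc.trans_le hax
        gcongr)
      0 Set.self_mem_Ici t ht ht
    simpa using this
  refine ⟨M ^ 2 / (2 * c * w 0 ^ 2), ?_⟩
  have h := hgrowth (M ^ 2 / (2 * c * w 0 ^ 2)) (by positivity)
  rw [mul_div_cancel₀ _ hk.ne'] at h
  exact (le_abs_self M).trans_lt (sq_lt_sq.mp (by linarith))

/-- if β : ℝ → ℝ is continuous with β ≥ b > 0 and γ = (γ₁,γ₂) : ℝ → ℝ²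
is a differentiable curve satisfying γ₁' = β·γ₂ and γ₂' = 2β·γ₁ with γ(0) ≠ (0,0),
then the range of γ is unbounded in ℝ². Thus a Reeb flow line of the handle model
whose planar coordinate is not at the origin escapes the handle. -/
theorem handle_flow_escape (b : ℝ) (hb : 0 < b) (β γ₁ γ₂ : ℝ → ℝ)
    (hβ : Continuous β) (hβb : ∀ t, b ≤ β t)
    (h₁ : ∀ t, HasDerivAt γ₁ (β t * γ₂ t) t)
    (h₂ : ∀ t, HasDerivAt γ₂ (2 * β t * γ₁ t) t)
    (h0 : ¬(γ₁ 0 = 0 ∧ γ₂ 0 = 0)) :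
    ¬ Bornology.IsBounded (Set.range fun t => ((γ₁ t, γ₂ t) : ℝ × ℝ)) := by
  intro hbdd
  obtain ⟨R, hR⟩ := hbdd.exists_norm_le
  have hγ : ∀ t, |γ₁ t| ≤ R ∧ |γ₂ t| ≤ R := fun t => by
    simpa [Prod.norm_def] using hR _ (Set.mem_range_self t)
  have hs : √2 * √2 = (2 : ℝ) := Real.mul_self_sqrt (by norm_num)
  have hs0 : 0 < √(2 : ℝ) := by positivity
  have hrate : ∀ t, √2 * b ≤ √2 * β t := fun t => by gcongr; exact hβb t
  by_cases hu : √2 * γ₁ 0 + γ₂ 0 = 0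
  · have hv : √2 * γ₁ (-0) - γ₂ (-0) ≠ 0 := fun hv => by
      rw [neg_zero] at hv
      have hγ₁ : γ₁ 0 = 0 := (mul_eq_zero.mp (by linarith : √2 * γ₁ 0 = 0)).resolve_left hs0.ne'
      exact h0 ⟨hγ₁, by linarith⟩
    obtain ⟨t, ht⟩ := exists_lt_abs_of_hasDerivAt_mul_self (c := √2 * b)
      (a := fun t => √2 * β (-t)) (w := fun t => √2 * γ₁ (-t) - γ₂ (-t)) (by positivity)
      (fun t => hrate (-t))
      (fun t => by
        have hd := (((h₁ (-t)).const_mul √2).sub (h₂ (-t))).comp t (hasDerivAt_neg t)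
        refine hd.congr_deriv ?_
        linear_combination -(β (-t) * γ₁ (-t)) * hs)
      hv (√2 * R + R)
    have htri := abs_sub (√2 * γ₁ (-t)) (γ₂ (-t))
    rw [abs_mul, abs_of_pos hs0] at htri
    have := mul_le_mul_of_nonneg_left (hγ (-t)).1 hs0.le
    linarith [(hγ (-t)).2]
  · obtain ⟨t, ht⟩ := exists_lt_abs_of_hasDerivAt_mul_self (c := √2 * b)
      (a := fun t => √2 * β t) (w := fun t => √2 * γ₁ t + γ₂ t) (by positivity) hrate
      (fun t => by
        refine (((h₁ t).const_mul √2).add (h₂ t)).congr_deriv ?_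
        linear_combination -(β t * γ₁ t) * hs)
      hu (√2 * R + R)
    have htri := abs_add_le (√2 * γ₁ t) (γ₂ t)
    rw [abs_mul, abs_of_pos hs0] at htri
    have := mul_le_mul_of_nonneg_left (hγ t).1 hs0.le
    linarith [(hγ t).2]
end
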